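/- With the notations of the context, for all z ∈ ℂ and all (s, τ) ∈ ℝ² the compatibility condition ∂U(z; s, τ)/∂s = ∂V(z; s, τ)/∂z − U(z; s, τ)·V(z; s, τ) + V(z; s, τ)·U(z; s, τ) holds as an identity of 4×4 complex matrices. -/

import Mathlib

open Real Complex

/-- The Painlevé II Hamiltonian has derivative `-q ^ 2` along solutions. -/
lemma hasDerivAt_painleveII_hamiltonian {q qp : ℝ → ℝ}
    (hq : ∀ x, HasDerivAt q (qp x) x)
    (hqp : ∀ x, HasDerivAt qp (x * q x + 2 * q x ^ 3) x) (x : ℝ) :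
    HasDerivAt (fun x => qp x ^ 2 - x * q x ^ 2 - q x ^ 4) (-(q x ^ 2)) x := by
  refine ((((hqp x).pow 2).sub ((hasDerivAt_id x).mul ((hq x).pow 2))).sub
    ((hq x).pow 4)).congr_deriv ?_
  simp
  ring

/-- The scaled Painlevé transcendent, its derivative and the scaled Hamiltonian along a curve
with velocity `A / C`. -/
lemma hasDerivAt_scaled_painleveII {q qp g : ℝ → ℝ} {A C s : ℝ}
    (hq : ∀ x, HasDerivAt q (qp x) x)
    (hqp : ∀ x, HasDerivAt qp (x * q x + 2 * q x ^ 3) x)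
    (hg : HasDerivAt g (C⁻¹ * A) s) :
    HasDerivAt (fun s => q (g s) / C) (A * (qp (g s) / C ^ 2)) s ∧
    HasDerivAt (fun s => qp (g s) / C ^ 2)
      (A * (g s * q (g s) / C ^ 3 + 2 * (q (g s) / C) ^ 3)) s ∧
    HasDerivAt (fun s => -(C⁻¹ * (qp (g s) ^ 2 - g s * q (g s) ^ 2 - q (g s) ^ 4)))
      (A * (q (g s) / C) ^ 2) s := by
  refine ⟨?_, ?_, ?_⟩
  · exact (((hq (g s)).comp s hg).div_const C).congr_deriv (by ring)
  · exact (((hqp (g s)).comp s hg).div_const (C ^ 2)).congr_deriv (by ring)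
  · exact ((((hasDerivAt_painleveII_hamiltonian hq hqp (g s)).comp s hg).const_mul
      C⁻¹).neg).congr_deriv (by ring)

set_option maxHeartbeats 4000000 in
/-- **The `s`-compatibility condition of the Lax pair for the tacnode Riemann–Hilbert
problem**: `∂U/∂s = ∂V/∂z - U V + V U`, verified directly from the Painlevé II equation. -/
theorem Lax_pair_s_compatibility
    (q qp : ℝ → ℝ)
    (hq : ∀ x, HasDerivAt q (qp x) x)
    (hqp : ∀ x, HasDerivAt qp (x * q x + 2 * q x ^ 3) x)
    (u : ℝ → ℝ) (hu : ∀ x, u x = qp x ^ 2 - x * q x ^ 2 - q x ^ 4)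
    (r₁ r₂ : ℝ) (hr₁ : 0 < r₁) (hr₂ : 0 < r₂) (σ₁ σ₂ : ℝ)
    (C : ℝ) (hC : C = ((r₁ ^ 2)⁻¹ + (r₂ ^ 2)⁻¹) ^ ((1 : ℝ) / 3))
    (Df σf df dtf cf ctf bf btf βf βtf : ℝ → ℝ → ℝ)
    (hDf : ∀ s τ, Df s τ = Real.sqrt (r₁ / r₂) *
      Real.exp ((r₁ ^ 4 - r₂ ^ 4) * τ ^ 3 / 3 + 2 * (r₂ * (σ₂ * s) - r₁ * (σ₁ * s)) * τ))
    (hσf : ∀ s τ, σf s τ =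
      C⁻¹ * (2 * (σ₁ * s / r₁ + σ₂ * s / r₂) - (r₁ ^ 2 + r₂ ^ 2) * τ ^ 2))
    (hdf : ∀ s τ, df s τ = q (σf s τ) / (r₂ * C * Df s τ))
    (hdtf : ∀ s τ, dtf s τ = Df s τ * q (σf s τ) / (r₁ * C))
    (hcf : ∀ s τ, cf s τ = ((σ₁ * s) ^ 2 - C⁻¹ * u (σf s τ)) / r₁)
    (hctf : ∀ s τ, ctf s τ = ((σ₂ * s) ^ 2 - C⁻¹ * u (σf s τ)) / r₂)
    (hbf : ∀ s τ, bf s τ = (ctf s τ + τ * r₂) * df s τ - qp (σf s τ) / (r₂ ^ 2 * C ^ 2 * Df s τ))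
    (hbtf : ∀ s τ, btf s τ = (cf s τ + τ * r₁) * dtf s τ - Df s τ * qp (σf s τ) / (r₁ ^ 2 * C ^ 2))
    (hβf : ∀ s τ, βf s τ = (ctf s τ - τ * r₂) * dtf s τ - Df s τ * qp (σf s τ) / (r₁ * r₂ * C ^ 2))
    (hβtf : ∀ s τ, βtf s τ = (cf s τ - τ * r₁) * df s τ - qp (σf s τ) / (r₁ * r₂ * C ^ 2 * Df s τ))
    (U V : ℂ → ℝ → ℝ → Matrix (Fin 4) (Fin 4) ℂ)
    (hU : ∀ (z : ℂ) (s τ : ℝ), U z s τ =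
      !![((-(r₁ * cf s τ) + r₁ ^ 2 * τ : ℝ) : ℂ), ((r₂ * df s τ : ℝ) : ℂ),
            (r₁ : ℂ) * Complex.I, 0;
        ((-(r₁ * dtf s τ) : ℝ) : ℂ), ((r₂ * ctf s τ - r₂ ^ 2 * τ : ℝ) : ℂ), 0,
            (r₂ : ℂ) * Complex.I;
        Complex.I * (((r₁ * cf s τ ^ 2 - r₂ * df s τ * dtf s τ - 2 * (σ₁ * s) : ℝ) : ℂ)
              + (r₁ : ℂ) * z),
          -Complex.I * ((r₁ * bf s τ + r₂ * βtf s τ : ℝ) : ℂ),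
          ((r₁ * cf s τ + r₁ ^ 2 * τ : ℝ) : ℂ), ((r₁ * df s τ : ℝ) : ℂ);
        -Complex.I * ((r₁ * βf s τ + r₂ * btf s τ : ℝ) : ℂ),
          Complex.I * (((r₂ * ctf s τ ^ 2 - r₁ * df s τ * dtf s τ - 2 * (σ₂ * s) : ℝ) : ℂ)
              - (r₂ : ℂ) * z),
          ((-(r₂ * dtf s τ) : ℝ) : ℂ), ((-(r₂ * ctf s τ) - r₂ ^ 2 * τ : ℝ) : ℂ)])
    (hV : ∀ (z : ℂ) (s τ : ℝ), V z s τ = (2 : ℂ) •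
      !![((σ₁ * cf s τ : ℝ) : ℂ), ((σ₂ * df s τ : ℝ) : ℂ), -((σ₁ : ℝ) : ℂ) * Complex.I, 0;
        ((σ₁ * dtf s τ : ℝ) : ℂ), ((σ₂ * ctf s τ : ℝ) : ℂ), 0, ((σ₂ : ℝ) : ℂ) * Complex.I;
        Complex.I * ((σ₁ : ℝ) : ℂ) *
            (((-(cf s τ ^ 2) + r₂ / r₁ * (df s τ * dtf s τ) + σ₁ / r₁ * s : ℝ) : ℂ) - z),
          Complex.I * ((σ₁ * bf s τ - σ₂ * βtf s τ : ℝ) : ℂ),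
          ((-(σ₁ * cf s τ) : ℝ) : ℂ), ((-(σ₁ * df s τ) : ℝ) : ℂ);
        Complex.I * ((σ₁ * βf s τ - σ₂ * btf s τ : ℝ) : ℂ),
          Complex.I * ((σ₂ : ℝ) : ℂ) *
            (((ctf s τ ^ 2 - r₁ / r₂ * (df s τ * dtf s τ) - σ₂ / r₂ * s : ℝ) : ℂ) - z),
          ((-(σ₂ * dtf s τ) : ℝ) : ℂ), ((-(σ₂ * ctf s τ) : ℝ) : ℂ)]) :
    ∀ (z : ℂ) (s τ : ℝ) (i j : Fin 4),
      HasDerivAt (fun s' => U z s' τ i j)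
        (deriv (fun z' => V z' s τ i j) z
          - (U z s τ * V z s τ) i j + (V z s τ * U z s τ) i j) s := by
  intro z s τ
  have hr₁' : r₁ ≠ 0 := hr₁.ne'
  have hr₂' : r₂ ≠ 0 := hr₂.ne'
  have hCpos : 0 < C := by rw [hC]; positivity
  have hC' : C ≠ 0 := hCpos.ne'
  have hC3 : C ^ 3 = (r₁ ^ 2)⁻¹ + (r₂ ^ 2)⁻¹ := by
    rw [hC, ← Real.rpow_natCast, ← Real.rpow_mul (by positivity)]
    norm_num
  have hDpos : ∀ s, 0 < Df s τ := fun s => by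
    rw [hDf]
    have : 0 < Real.sqrt (r₁ / r₂) := Real.sqrt_pos.mpr (div_pos hr₁ hr₂)
    positivity
  set A : ℝ := 2 * (σ₁ / r₁ + σ₂ / r₂) with hA
  have hσd : HasDerivAt (fun s => σf s τ) (C⁻¹ * A) s := by
    simp only [hσf]
    refine (((((((hasDerivAt_id s).const_mul σ₁).div_const r₁).add
      (((hasDerivAt_id s).const_mul σ₂).div_const r₂)).const_mul 2).sub_const _).const_mul
      C⁻¹).congr_deriv ?_
    rw [hA, mul_one, mul_one]
  have hDd : HasDerivAt (fun s => Df s τ) (2 * (r₂ * σ₂ - r₁ * σ₁) * τ * Df s τ) s := by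
    simp only [hDf]
    refine ((((((((hasDerivAt_id s).const_mul σ₂).const_mul r₂).sub
      (((hasDerivAt_id s).const_mul σ₁).const_mul r₁)).const_mul 2).mul_const
      τ).const_add _).exp.const_mul _).congr_deriv ?_
    simp only [id, Pi.sub_apply]
    ring
  obtain ⟨hQd, hPd, hHd⟩ := hasDerivAt_scaled_painleveII hq hqp hσd
  set Q : ℝ → ℝ := fun s => q (σf s τ) / C with hQ
  set P : ℝ → ℝ := fun s => qp (σf s τ) / C ^ 2 with hP
  set H : ℝ → ℝ :=
    fun s => -(C⁻¹ * (qp (σf s τ) ^ 2 - σf s τ * q (σf s τ) ^ 2 - q (σf s τ) ^ 4)) with hH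
  set D : ℝ → ℝ := fun s => Df s τ with hD
  have hPd' : HasDerivAt P (A * ((2 * (σ₁ * s / r₁ + σ₂ * s / r₂) - (r₁ ^ 2 + r₂ ^ 2) * τ ^ 2) *
      Q s * (r₁ ^ 2 * r₂ ^ 2 / (r₁ ^ 2 + r₂ ^ 2)) + 2 * Q s ^ 3)) s := by
    refine hPd.congr_deriv ?_
    have hC3' : r₁ ^ 2 * r₂ ^ 2 / (r₁ ^ 2 + r₂ ^ 2) = (C ^ 3)⁻¹ := by
      rw [hC3]
      field_simp
      ring
    rw [hC3']
    simp only [hQ, hσf s τ]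
    field_simp
  have hd : ∀ s, df s τ = Q s / (r₂ * D s) := fun s => by
    have := (hDpos s).ne'
    simp only [hdf, hQ, hD]; field_simp
  have hdt : ∀ s, dtf s τ = D s * Q s / r₁ := fun s => by
    simp only [hdtf, hQ, hD]; field_simp
  have hc : ∀ s, cf s τ = ((σ₁ * s) ^ 2 + H s) / r₁ := fun s => by
    rw [hcf, hu]; ring
  have hct : ∀ s, ctf s τ = ((σ₂ * s) ^ 2 + H s) / r₂ := fun s => by
    rw [hctf, hu]; ring
  have hb : ∀ s, bf s τ = (ctf s τ + τ * r₂) * df s τ - P s / (r₂ ^ 2 * D s) := fun s => by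
    have := (hDpos s).ne'
    simp only [hbf, hP, hD]; field_simp
  have hbt : ∀ s, btf s τ = (cf s τ + τ * r₁) * dtf s τ - D s * P s / r₁ ^ 2 := fun s => by
    simp only [hbtf, hP, hD]; field_simp
  have hβ : ∀ s, βf s τ = (ctf s τ - τ * r₂) * dtf s τ - D s * P s / (r₁ * r₂) := fun s => by
    simp only [hβf, hP, hD]; field_simp
  have hβt : ∀ s, βtf s τ = (cf s τ - τ * r₁) * df s τ - P s / (r₁ * r₂ * D s) := fun s => by
    have := (hDpos s).ne'
    simp only [hβtf, hP, hD]; field_simp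
  have hDs : D s ≠ 0 := (hDpos s).ne'
  replace hQd : HasDerivAt Q (A * P s) s := hQd
  replace hHd : HasDerivAt H (A * Q s ^ 2) s := hHd
  replace hDd : HasDerivAt D (2 * (r₂ * σ₂ - r₁ * σ₁) * τ * D s) s := hDd
  clear_value Q P H D
  have hdd : HasDerivAt (fun s => df s τ)
      (A * P s / (r₂ * D s) - 2 * (r₂ * σ₂ - r₁ * σ₁) * τ * (Q s / (r₂ * D s))) s := by
    simp only [hd]
    exact (hQd.div (hDd.const_mul r₂) (mul_ne_zero hr₂' hDs)).congr_deriv (by field_simp)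
  have hdtd : HasDerivAt (fun s => dtf s τ)
      (A * D s * P s / r₁ + 2 * (r₂ * σ₂ - r₁ * σ₁) * τ * (D s * Q s / r₁)) s := by
    simp only [hdt]
    exact ((hDd.mul hQd).div_const r₁).congr_deriv (by ring)
  have hcd : HasDerivAt (fun s => cf s τ) ((2 * σ₁ ^ 2 * s + A * Q s ^ 2) / r₁) s := by
    simp only [hc]
    exact (((((hasDerivAt_id s).const_mul σ₁).pow 2).add hHd).div_const r₁).congr_deriv
      (by simp; ring)
  have hctd : HasDerivAt (fun s => ctf s τ) ((2 * σ₂ ^ 2 * s + A * Q s ^ 2) / r₂) s := by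
    simp only [hct]
    exact (((((hasDerivAt_id s).const_mul σ₂).pow 2).add hHd).div_const r₂).congr_deriv
      (by simp; ring)
  set P' : ℝ := A * ((2 * (σ₁ * s / r₁ + σ₂ * s / r₂) - (r₁ ^ 2 + r₂ ^ 2) * τ ^ 2) *
      Q s * (r₁ ^ 2 * r₂ ^ 2 / (r₁ ^ 2 + r₂ ^ 2)) + 2 * Q s ^ 3) with hP'
  have hbd : HasDerivAt (fun s => bf s τ)
      ((2 * σ₂ ^ 2 * s + A * Q s ^ 2) / r₂ * df s τ +
        (ctf s τ + τ * r₂) *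
          (A * P s / (r₂ * D s) - 2 * (r₂ * σ₂ - r₁ * σ₁) * τ * (Q s / (r₂ * D s))) -
        (P' - 2 * (r₂ * σ₂ - r₁ * σ₁) * τ * P s) / (r₂ ^ 2 * D s)) s := by
    simp only [hb]
    exact (((hctd.add_const (τ * r₂)).mul hdd).sub
      (hPd'.div (hDd.const_mul (r₂ ^ 2)) (mul_ne_zero (pow_ne_zero 2 hr₂') hDs))).congr_deriv
      (by field_simp)
  have hbtd : HasDerivAt (fun s => btf s τ)
      ((2 * σ₁ ^ 2 * s + A * Q s ^ 2) / r₁ * dtf s τ +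
        (cf s τ + τ * r₁) *
          (A * D s * P s / r₁ + 2 * (r₂ * σ₂ - r₁ * σ₁) * τ * (D s * Q s / r₁)) -
        (2 * (r₂ * σ₂ - r₁ * σ₁) * τ * P s + P') * D s / r₁ ^ 2) s := by
    simp only [hbt]
    exact (((hcd.add_const (τ * r₁)).mul hdtd).sub
      ((hDd.mul hPd').div_const (r₁ ^ 2))).congr_deriv
      (by field_simp)
  have hβd : HasDerivAt (fun s => βf s τ)
      ((2 * σ₂ ^ 2 * s + A * Q s ^ 2) / r₂ * dtf s τ +
        (ctf s τ - τ * r₂) *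
          (A * D s * P s / r₁ + 2 * (r₂ * σ₂ - r₁ * σ₁) * τ * (D s * Q s / r₁)) -
        (2 * (r₂ * σ₂ - r₁ * σ₁) * τ * P s + P') * D s / (r₁ * r₂)) s := by
    simp only [hβ]
    exact (((hctd.sub_const (τ * r₂)).mul hdtd).sub
      ((hDd.mul hPd').div_const (r₁ * r₂))).congr_deriv
      (by field_simp)
  have hβtd : HasDerivAt (fun s => βtf s τ)
      ((2 * σ₁ ^ 2 * s + A * Q s ^ 2) / r₁ * df s τ +
        (cf s τ - τ * r₁) *
          (A * P s / (r₂ * D s) - 2 * (r₂ * σ₂ - r₁ * σ₁) * τ * (Q s / (r₂ * D s))) -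
        (P' - 2 * (r₂ * σ₂ - r₁ * σ₁) * τ * P s) / (r₁ * r₂ * D s)) s := by
    simp only [hβt]
    exact (((hcd.sub_const (τ * r₁)).mul hdd).sub
      (hPd'.div (hDd.const_mul (r₁ * r₂)) (mul_ne_zero (mul_ne_zero hr₁' hr₂') hDs))).congr_deriv
      (by field_simp)
  have hVd : ∀ i j, deriv (fun z' => V z' s τ i j) z =
      (!![0, 0, 0, 0; 0, 0, 0, 0; -2 * Complex.I * (σ₁ : ℂ), 0, 0, 0;
        0, -2 * Complex.I * (σ₂ : ℂ), 0, 0] : Matrix (Fin 4) (Fin 4) ℂ) i j := by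
    intro i j
    simp only [hV]
    fin_cases i <;> fin_cases j <;> simp <;> ring
  have hr₁c : (r₁ : ℂ) ≠ 0 := by exact_mod_cast hr₁'
  have hr₂c : (r₂ : ℂ) ≠ 0 := by exact_mod_cast hr₂'
  have hDc : (D s : ℂ) ≠ 0 := by exact_mod_cast hDs
  have hrc : (r₁ : ℂ) ^ 2 + (r₂ : ℂ) ^ 2 ≠ 0 := by
    exact_mod_cast (by positivity : r₁ ^ 2 + r₂ ^ 2 ≠ 0)
  intro i j
  rw [hVd i j]
  clear hVd
  rw [hU z s, hV z s]
  simp only [hU]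
  clear hU hV hdf hdtf hcf hctf hbf hbtf hβf hβtf hσf hDf hq hqp hu
    hC hC3 hPd hQ hP hH hD hσd hDpos
  fin_cases i <;> fin_cases j
  · refine (((hcd.const_mul r₁).neg.add_const (r₁ ^ 2 * τ)).ofReal_comp).congr_deriv ?_
    simp [Matrix.mul_apply, Fin.sum_univ_four, hb, hbt, hβ, hβt, hd, hdt, hc, hct, hA]
    field_simp
    ring_nf
    simp only [Complex.I_sq]
    ring
  · refine ((hdd.const_mul r₂).ofReal_comp).congr_deriv ?_
    simp [Matrix.mul_apply, Fin.sum_univ_four, hb, hbt, hβ, hβt, hd, hdt, hc, hct, hA]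
    field_simp
    ring_nf
    simp only [Complex.I_sq]
    ring
  · refine (hasDerivAt_const s _).congr_deriv ?_
    simp [Matrix.mul_apply, Fin.sum_univ_four, hb, hbt, hβ, hβt, hd, hdt, hc, hct]
    field_simp
    ring
  · refine (hasDerivAt_const s _).congr_deriv ?_
    simp [Matrix.mul_apply, Fin.sum_univ_four, hb, hbt, hβ, hβt, hd, hdt, hc, hct]
    field_simp
    ring
  · refine ((hdtd.const_mul r₁).neg.ofReal_comp).congr_deriv ?_
    simp [Matrix.mul_apply, Fin.sum_univ_four, hb, hbt, hβ, hβt, hd, hdt, hc, hct, hA]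
    field_simp
    ring_nf
    simp only [Complex.I_sq]
    ring
  · refine (((hctd.const_mul r₂).sub_const (r₂ ^ 2 * τ)).ofReal_comp).congr_deriv ?_
    simp [Matrix.mul_apply, Fin.sum_univ_four, hb, hbt, hβ, hβt, hd, hdt, hc, hct, hA]
    field_simp
    ring_nf
    simp only [Complex.I_sq]
    ring
  · refine (hasDerivAt_const s _).congr_deriv ?_
    simp [Matrix.mul_apply, Fin.sum_univ_four, hb, hbt, hβ, hβt, hd, hdt, hc, hct]
    field_simp
    ring
  · refine (hasDerivAt_const s _).congr_deriv ?_
    simp [Matrix.mul_apply, Fin.sum_univ_four, hb, hbt, hβ, hβt, hd, hdt, hc, hct]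
    field_simp
    ring
  · refine ((((((hcd.pow 2).const_mul r₁).sub ((hdd.const_mul r₂).mul hdtd)).sub
      (((hasDerivAt_id s).const_mul σ₁).const_mul 2)).ofReal_comp.add_const
      ((r₁ : ℂ) * z)).const_mul Complex.I).congr_deriv ?_
    simp [Matrix.mul_apply, Fin.sum_univ_four, hb, hbt, hβ, hβt, hd, hdt, hc, hct, hA]
    field_simp
    ring
  · refine ((((hbd.const_mul r₁).add (hβtd.const_mul r₂)).ofReal_comp).const_mul
      (-Complex.I)).congr_deriv ?_
    simp [Matrix.mul_apply, Fin.sum_univ_four, hb, hbt, hβ, hβt, hd, hdt, hc, hct, hA, hP']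
    field_simp
    ring
  · refine (((hcd.const_mul r₁).add_const (r₁ ^ 2 * τ)).ofReal_comp).congr_deriv ?_
    simp [Matrix.mul_apply, Fin.sum_univ_four, hb, hbt, hβ, hβt, hd, hdt, hc, hct, hA]
    field_simp
    ring_nf
    simp only [Complex.I_sq]
    ring
  · refine ((hdd.const_mul r₁).ofReal_comp).congr_deriv ?_
    simp [Matrix.mul_apply, Fin.sum_univ_four, hb, hbt, hβ, hβt, hd, hdt, hc, hct, hA]
    field_simp
    ring_nf
    simp only [Complex.I_sq]
    ring
  · refine ((((hβd.const_mul r₁).add (hbtd.const_mul r₂)).ofReal_comp).const_mul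
      (-Complex.I)).congr_deriv ?_
    simp [Matrix.mul_apply, Fin.sum_univ_four, hb, hbt, hβ, hβt, hd, hdt, hc, hct, hA, hP']
    field_simp
    ring
  · refine ((((((hctd.pow 2).const_mul r₂).sub ((hdd.const_mul r₁).mul hdtd)).sub
      (((hasDerivAt_id s).const_mul σ₂).const_mul 2)).ofReal_comp.sub_const
      ((r₂ : ℂ) * z)).const_mul Complex.I).congr_deriv ?_
    simp [Matrix.mul_apply, Fin.sum_univ_four, hb, hbt, hβ, hβt, hd, hdt, hc, hct, hA]
    field_simp
    ring
  · refine ((hdtd.const_mul r₂).neg.ofReal_comp).congr_deriv ?_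
    simp [Matrix.mul_apply, Fin.sum_univ_four, hb, hbt, hβ, hβt, hd, hdt, hc, hct, hA]
    field_simp
    ring_nf
    simp only [Complex.I_sq]
    ring
  · refine (((hctd.const_mul r₂).neg.sub_const (r₂ ^ 2 * τ)).ofReal_comp).congr_deriv ?_
    simp [Matrix.mul_apply, Fin.sum_univ_four, hb, hbt, hβ, hβt, hd, hdt, hc, hct, hA]
    field_simp
    ring_nf
    simp only [Complex.I_sq]
    ring
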